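/- arXiv:1805.05496 — 2 statements merged into one kernel-verified Lean document; each statement's English description precedes it below -/
import Mathlib

section
/- Let A be an abelian group admitting a finite decreasing chain of subgroups A = F_0 ⊇ F_1 ⊇ ⋯ ⊇ F_m (with m ≥ 1) such that: (i) F_m consists of torsion elements; (ii) for every i with 1 ≤ i < m the quotient F_i/F_{i+1} is divisible; and (iii) F_0/F_1 is the internal direct sum of a divisible subgroup and a finite subgroup. Then A/Tor(A) is divisible and torsion-free. -/
/-- An abelian group `A` is divisible if for every nonzero integer `n` and every `a ∈ A`
there exists `b ∈ A` with `n • b = a`. -/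
def IsDivisibleGroup (A : Type*) [AddCommGroup A] : Prop :=
  ∀ n : ℤ, n ≠ 0 → ∀ a : A, ∃ b : A, n • b = a

/-- A subgroup `H` is divisible modulo torsion if each of its elements differs from an
`n`-th multiple in `H` by a torsion element, for every nonzero `n`. -/
def IsDivisibleModTorsion {A : Type*} [AddCommGroup A] (H : AddSubgroup A) : Prop :=
  ∀ n : ℤ, n ≠ 0 → ∀ x ∈ H, ∃ y ∈ H, x - n • y ∈ AddCommGroup.torsion A

theorem mem_torsion_of_zsmul_mem {A : Type*} [AddCommGroup A] {n : ℤ} (hn : n ≠ 0) {x : A}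
    (h : n • x ∈ AddCommGroup.torsion A) : x ∈ AddCommGroup.torsion A := by
  obtain ⟨k, hk, hkx⟩ := isOfFinAddOrder_iff_zsmul_eq_zero.mp h
  exact isOfFinAddOrder_iff_zsmul_eq_zero.mpr
    ⟨k * n, mul_ne_zero hk hn, by rw [mul_smul, hkx]⟩

/-- Divisibility modulo torsion passes from `K` to `H ≥ K` when `H / K` is divisible up to
elements killed by a fixed nonzero integer `N`. -/
theorem IsDivisibleModTorsion.of_quotient {A : Type*} [AddCommGroup A] {H K : AddSubgroup A}
    (hK : IsDivisibleModTorsion K) (hKH : K ≤ H) {N : ℤ} (hN : N ≠ 0)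
    (hq : ∀ n : ℤ, n ≠ 0 → ∀ q : ↥H ⧸ K.addSubgroupOf H,
      ∃ r : ↥H ⧸ K.addSubgroupOf H, N • (q - n • r) = 0) :
    IsDivisibleModTorsion H := by
  intro n hn x hx
  obtain ⟨r, hr⟩ := hq n hn (QuotientAddGroup.mk ⟨x, hx⟩)
  obtain ⟨y, rfl⟩ := QuotientAddGroup.mk_surjective r
  have hy : N • (x - n • (y : A)) ∈ K :=
    by
    rw [← QuotientAddGroup.mk_zsmul, ← QuotientAddGroup.mk_sub, ← QuotientAddGroup.mk_zsmul,
      QuotientAddGroup.eq_zero_iff] at hr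
    exact hr
  obtain ⟨z, hz, ht⟩ := hK (N * n) (mul_ne_zero hN hn) _ hy
  refine ⟨y + z, H.add_mem y.2 (hKH hz), mem_torsion_of_zsmul_mem hN ?_⟩
  convert ht using 1
  module

/-- A sum of a divisible and a finite subgroup is divisible up to elements killed by the order
of the finite subgroup. -/
theorem exists_card_smul_sub_zsmul_eq_zero {Q : Type*} [AddCommGroup Q] {D E : AddSubgroup Q}
    (hD : IsDivisibleGroup D) (hDE : D ⊔ E = ⊤) {n : ℤ} (hn : n ≠ 0) (q : Q) :
    ∃ r : Q, (Nat.card E : ℤ) • (q - n • r) = 0 := by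
  obtain ⟨d, hd, e, he, rfl⟩ := AddSubgroup.mem_sup.mp (hDE ▸ AddSubgroup.mem_top q)
  obtain ⟨r, hr⟩ := hD n hn ⟨d, hd⟩
  have hr' : n • (r : Q) = d := congrArg Subtype.val hr
  have he' : Nat.card E • e = 0 := congrArg Subtype.val (card_nsmul_eq_zero' (x := (⟨e, he⟩ : E)))
  exact ⟨r, by rw [hr', add_sub_cancel_left, natCast_zsmul, he']⟩

/-- Let `A = F_0 ⊇ F_1 ⊇ ⋯ ⊇ F_m` (with `m ≥ 1`) be a finite decreasing chain of
subgroups such that `F_m` is torsion, the quotients `F_i / F_{i+1}` are divisible for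
`1 ≤ i < m`, and `F_0 / F_1` is the internal direct sum of a divisible subgroup and a
finite subgroup. Then `A / Tor(A)` is divisible and torsion-free. -/
theorem quotient_torsion_uniquely_divisible_of_filtration
    {A : Type*} [AddCommGroup A] (m : ℕ) (hm : 1 ≤ m) (F : ℕ → AddSubgroup A)
    (h0 : F 0 = ⊤)
    (hdec : ∀ i, i < m → F (i + 1) ≤ F i)
    (htor : F m ≤ AddCommGroup.torsion A)
    (hdiv : ∀ i, 1 ≤ i → i < m →
      IsDivisibleGroup (↥(F i) ⧸ (F (i + 1)).addSubgroupOf (F i)))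
    (hsplit : ∃ D E : AddSubgroup (↥(F 0) ⧸ (F 1).addSubgroupOf (F 0)),
      IsDivisibleGroup D ∧ Finite E ∧ D ⊓ E = ⊥ ∧ D ⊔ E = ⊤) :
    IsDivisibleGroup (A ⧸ AddCommGroup.torsion A) ∧
      ∀ (x : A ⧸ AddCommGroup.torsion A) (n : ℤ), n ≠ 0 → n • x = 0 → x = 0 := by
  have htop : IsDivisibleModTorsion (F 0) := by
    have h1 : IsDivisibleModTorsion (F 1) := by
      refine Nat.decreasingInduction' (P := fun i => IsDivisibleModTorsion (F i))
        (fun i hi hi1 ih => ?_) hm fun n _ x hx => ⟨0, zero_mem _, by simpa using htor hx⟩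
      refine ih.of_quotient (hdec i hi) one_ne_zero fun n hn q => ?_
      obtain ⟨r, hr⟩ := hdiv i hi1 hi n hn q
      exact ⟨r, by rw [hr, sub_self, smul_zero]⟩
    obtain ⟨D, E, hD, hE, -, hDE⟩ := hsplit
    exact h1.of_quotient (hdec 0 hm) (Nat.cast_ne_zero.mpr Nat.card_pos.ne')
      fun n hn q => exists_card_smul_sub_zsmul_eq_zero hD hDE hn q
  constructor
  · intro n hn a
    obtain ⟨x, rfl⟩ := QuotientAddGroup.mk_surjective a
    obtain ⟨y, -, hy⟩ := htop n hn x (h0 ▸ AddSubgroup.mem_top x)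
    exact ⟨QuotientAddGroup.mk y, (sub_eq_zero.mp ((QuotientAddGroup.eq_zero_iff _).mpr hy)).symm⟩
  · intro a n hn h
    obtain ⟨x, rfl⟩ := QuotientAddGroup.mk_surjective a
    exact (QuotientAddGroup.eq_zero_iff _).mpr
      (mem_torsion_of_zsmul_mem hn ((QuotientAddGroup.eq_zero_iff _).mp h))
end

section
/- Let G be a commutative group (written multiplicatively), H an abelian group, r ≥ 1, and let s : G^r → H be a map that is multiadditive in each coordinate (not necessarily symmetric). Then for all x_1, …, x_r ∈ G: ∑_{S ⊆ {1,…,r}} (−1)^{r−|S|} s(p_S, p_S, …, p_S) = ∑_{σ ∈ Sym(r)} s(x_{σ(1)}, x_{σ(2)}, …, x_{σ(r)}), where p_S = ∏_{i∈S} x_i (and p_∅ = 1), and Sym(r) is the symmetric group on {1,…,r}. -/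
open Finset

/-- The alternating sum over the finsets containing `T` vanishes unless `T` is everything. -/
theorem sum_neg_one_pow_card_compl_of_subset {ι : Type*} [Fintype ι] [DecidableEq ι]
    (T : Finset ι) :
    (∑ S : Finset ι, if T ⊆ S then (-1 : ℤ) ^ (Fintype.card ι - #S) else 0) =
      if T = univ then 1 else 0 := by
  simp_rw [← Finset.compl_eq_empty_iff T]
  rw [← sum_filter, ← sum_powerset_neg_one_pow_card]
  refine sum_nbij' compl compl ?_ ?_ ?_ ?_ ?_ <;>
    simp +contextual [card_compl, subset_compl_comm]

/-- Polarization identity for a multilinear map that need not be symmetric. -/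
theorem MultilinearMap.sum_neg_one_pow_smul_map_sum {R ι M N : Type*} [Semiring R]
    [Fintype ι] [DecidableEq ι] [AddCommMonoid M] [Module R M] [AddCommGroup N] [Module R N]
    (f : MultilinearMap R (fun _ : ι => M) N) (x : ι → M) :
    (∑ S : Finset ι, ((-1 : ℤ) ^ (Fintype.card ι - #S)) • f (fun _ => ∑ i ∈ S, x i)) =
      ∑ σ : Equiv.Perm ι, f (fun i => x (σ i)) := by
  have expand (S : Finset ι) :
      ((-1 : ℤ) ^ (Fintype.card ι - #S)) • f (fun _ => ∑ i ∈ S, x i) =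
        ∑ g : ι → ι, (if univ.image g ⊆ S then (-1 : ℤ) ^ (Fintype.card ι - #S) else 0) •
          f (fun i => x (g i)) := by
    have hS : Fintype.piFinset (fun _ : ι => S) = univ.filter (fun g => univ.image g ⊆ S) := by
      ext g
      simp [image_subset_iff]
    rw [f.map_sum_finset (fun _ => x) (fun _ => S), hS, smul_sum, sum_filter]
    simp only [ite_smul, zero_smul]
  simp_rw [expand]
  rw [sum_comm]
  simp_rw [← sum_smul, sum_neg_one_pow_card_compl_of_subset, ite_smul, one_smul, zero_smul]
  rw [← sum_filter]
  symm
  refine sum_bij (fun σ _ => σ) ?_ ?_ ?_ ?_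
  · intro σ _
    simp [image_univ_of_surjective σ.surjective]
  · intro σ _ τ _ h
    exact DFunLike.coe_injective h
  · intro g hg
    have hsurj : Function.Surjective g := by
      simpa [← Finset.coe_eq_univ, Set.range_eq_univ] using hg
    exact ⟨Equiv.ofBijective g (Finite.surjective_iff_bijective.mp hsurj), mem_univ _, rfl⟩
  · intro _ _
    rfl

/-- A map that is additive in each coordinate, as a `ℤ`-multilinear map. -/
def MultilinearMap.ofMapUpdateAdd {ι M N : Type*} [DecidableEq ι] [AddCommGroup M]
    [AddCommGroup N] (f : (ι → M) → N)
    (hf : ∀ (x : ι → M) (i : ι) (a b : M),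
      f (Function.update x i (a + b)) = f (Function.update x i a) + f (Function.update x i b)) :
    MultilinearMap ℤ (fun _ : ι => M) N :=
  MultilinearMap.mk' f hf fun x i c a =>
    map_zsmul (AddMonoidHom.mk' (fun a => f (Function.update x i a)) (hf x i)) c a

/-- Polarization identity for a multiadditive (not necessarily symmetric) map
`s : G^r → H`: `∑_{S ⊆ {1,…,r}} (−1)^{r−|S|} s(p_S, …, p_S) = ∑_{σ ∈ Sym(r)}
s(x_{σ(1)}, …, x_{σ(r)})`, where `p_S = ∏_{i∈S} x_i`. -/
theorem polarization_of_multiadditive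
    {G H : Type*} [CommGroup G] [AddCommGroup H] (r : ℕ) (hr : 1 ≤ r)
    (s : (Fin r → G) → H)
    (hadd : ∀ (x : Fin r → G) (i : Fin r) (a b : G),
      s (Function.update x i (a * b)) =
        s (Function.update x i a) + s (Function.update x i b))
    (x : Fin r → G) :
    (∑ S : Finset (Fin r),
        ((-1 : ℤ) ^ (r - S.card)) • s (fun _ => ∏ i ∈ S, x i)) =
      ∑ σ : Equiv.Perm (Fin r), s (fun i => x (σ i)) := by
  simpa using!
    (MultilinearMap.ofMapUpdateAdd (M := Additive G) s hadd).sum_neg_one_pow_smul_map_sum x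
end
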